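/- Let I be a countable index set and (X_i)_{i∈I} a family of random elements of a partially ordered Polish space X with closed partial order. If for every finite subset J ⊂ I the finite subfamily (X_i)_{i∈J} is negatively associated, then the whole family (X_i)_{i∈I} is negatively associated: for every subset J ⊂ I and all bounded measurable coordinatewise nondecreasing functions f : X^J → ℝ and g : X^{J^c} → ℝ, E[f(X_J) g(X_{J^c})] ≤ E[f(X_J)] E[g(X_{J^c})]. -/

import Mathlib

open MeasureTheory

/-- A family `(Xs i)_{i ∈ ι}` of random elements of a partially ordered measurable space `X`
is *negatively associated* if for every index set `J ⊆ ι` and all bounded measurable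
coordinatewise nondecreasing `f : X^J → ℝ`, `g : X^{Jᶜ} → ℝ`, one has
`E[f(X_J) g(X_{Jᶜ})] ≤ E[f(X_J)] E[g(X_{Jᶜ})]`. -/
def NegAssoc {Ω ι X : Type*} [MeasurableSpace Ω] [MeasurableSpace X] [Preorder X]
    (P : Measure Ω) (Xs : ι → Ω → X) : Prop :=
  ∀ (J : Set ι) (f : (J → X) → ℝ) (g : ((Jᶜ : Set ι) → X) → ℝ),
    Measurable f → Monotone f → (∃ C, ∀ x, |f x| ≤ C) →
    Measurable g → Monotone g → (∃ C, ∀ x, |g x| ≤ C) →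
    ∫ ω, f (fun j => Xs j.1 ω) * g (fun j => Xs j.1 ω) ∂P ≤
      (∫ ω, f (fun j => Xs j.1 ω) ∂P) * ∫ ω, g (fun j => Xs j.1 ω) ∂P

/-- The upper closure of a compact set is closed when the order is closed. -/
theorem IsCompact.isClosed_upperClosure {Y : Type*} [TopologicalSpace Y] [Preorder Y]
    [OrderClosedTopology Y] {K : Set Y} (hK : IsCompact K) :
    IsClosed (upperClosure K : Set Y) := by
  have : CompactSpace K := isCompact_iff_compactSpace.mp hK
  have hcl : IsClosed {p : K × Y | (p.1 : Y) ≤ p.2} :=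
    isClosed_le (continuous_subtype_val.comp continuous_fst) continuous_snd
  have := isClosedMap_snd_of_compactSpace _ hcl
  convert this using 1
  ext y
  simp [mem_upperClosure]

/-- A point whose finite-dimensional restrictions all dominate restrictions of points of a compact
set `K` dominates a point of `K`. -/
theorem mem_upperClosure_of_forall_restrict {α X : Type*} [TopologicalSpace X] [Preorder X]
    [OrderClosedTopology X] {K : Set (α → X)} (hK : IsCompact K) {x : α → X}
    (hx : ∀ F : Finset α, F.restrict x ∈ upperClosure (F.restrict '' K)) :
    x ∈ upperClosure K := by
  have hne : (K ∩ ⋂ i, {y : α → X | y i ≤ x i}).Nonempty := by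
    refine hK.inter_iInter_nonempty _ (fun i => isClosed_le (continuous_apply i) continuous_const)
      fun F => ?_
    obtain ⟨_, ⟨y, hy, rfl⟩, hle⟩ := mem_upperClosure.mp (hx F)
    exact ⟨y, hy, Set.mem_iInter₂.mpr fun i hi => hle ⟨i, hi⟩⟩
  obtain ⟨y, hy, hle⟩ := hne
  exact mem_upperClosure.mpr ⟨y, hy, fun i => Set.mem_iInter.mp hle i⟩

/-- `f` can be approximated in `L¹(μ)` by bounded measurable nondecreasing functions of finitely
many coordinates. -/
def FinDimApprox {α X : Type*} [MeasurableSpace X] [Preorder X]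
    (μ : Measure (α → X)) (f : (α → X) → ℝ) : Prop :=
  ∀ ε > 0, ∃ (F : Finset α) (h : (F → X) → ℝ), Measurable h ∧ Monotone h ∧
    (∃ C, ∀ x, |h x| ≤ C) ∧ ∫ x, |f x - h (F.restrict x)| ∂μ ≤ ε

theorem integrable_of_abs_le {Y : Type*} [MeasurableSpace Y] {μ : Measure Y} [IsFiniteMeasure μ]
    {f : Y → ℝ} (hf : Measurable f) (hb : ∃ C, ∀ x, |f x| ≤ C) : Integrable f μ := by
  obtain ⟨C, hC⟩ := hb
  exact Integrable.of_bound hf.aestronglyMeasurable C (Filter.Eventually.of_forall hC)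

theorem abs_indicator_one_le {Y : Type*} (s : Set Y) (x : Y) :
    |s.indicator (1 : Y → ℝ) x| ≤ 1 := by
  by_cases h : x ∈ s <;> simp [h]

theorem IsUpperSet.monotone_indicator_one {Y : Type*} [Preorder Y] {s : Set Y}
    (hs : IsUpperSet s) : Monotone (s.indicator (1 : Y → ℝ)) := by
  intro x y hxy
  by_cases hx : x ∈ s
  · simp [hx, hs hxy hx]
  · simp only [hx, not_false_eq_true, Set.indicator_of_notMem]
    exact Set.indicator_nonneg (fun _ _ => zero_le_one) y

theorem measurable_finset_restrict {α X : Type*} [MeasurableSpace X] (F : Finset α) :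
    Measurable (F.restrict : (α → X) → (F → X)) :=
  measurable_pi_lambda _ fun i => measurable_pi_apply i.1

namespace FinDimApprox

variable {α X : Type*} [MeasurableSpace X] {f g : (α → X) → ℝ}

theorem const [Preorder X] (μ : Measure (α → X)) (c : ℝ) : FinDimApprox μ fun _ => c :=
  fun ε hε => ⟨∅, fun _ => c, measurable_const, monotone_const, ⟨|c|, fun _ => le_rfl⟩,
    by simpa using hε.le⟩

theorem add [Preorder X] {μ : Measure (α → X)} [IsFiniteMeasure μ]
    (hf : FinDimApprox μ f) (hg : FinDimApprox μ g)
    (hfm : Measurable f) (hfb : ∃ C, ∀ x, |f x| ≤ C)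
    (hgm : Measurable g) (hgb : ∃ C, ∀ x, |g x| ≤ C) :
    FinDimApprox μ fun x => f x + g x := by
  classical
  intro ε hε
  obtain ⟨F, h, hm, hmono, ⟨C, hC⟩, hle⟩ := hf (ε / 2) (half_pos hε)
  obtain ⟨G, k, km, kmono, ⟨D, hD⟩, kle⟩ := hg (ε / 2) (half_pos hε)
  refine ⟨F ∪ G, fun x => h (Finset.restrict₂ (π := fun _ => X) Finset.subset_union_left x) +
    k (Finset.restrict₂ (π := fun _ => X) Finset.subset_union_right x), ?_, ?_, ⟨C + D, fun x => ?_⟩, ?_⟩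
  · exact (hm.comp (Finset.measurable_restrict₂ _)).add (km.comp (Finset.measurable_restrict₂ _))
  · exact fun x y hxy => add_le_add (hmono fun i => hxy _) (kmono fun i => hxy _)
  · exact (abs_add_le _ _).trans (add_le_add (hC _) (hD _))
  · have hi : Integrable (fun x => |f x - h (F.restrict x)|) μ :=
      ((integrable_of_abs_le hfm hfb).sub (integrable_of_abs_le
        (hm.comp (measurable_finset_restrict F)) ⟨C, fun x => hC _⟩)).abs
    have ki : Integrable (fun x => |g x - k (G.restrict x)|) μ :=
      ((integrable_of_abs_le hgm hgb).sub (integrable_of_abs_le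
        (km.comp (measurable_finset_restrict G)) ⟨D, fun x => hD _⟩)).abs
    calc _ ≤ ∫ x, (|f x - h (F.restrict x)| + |g x - k (G.restrict x)|) ∂μ := by
          refine integral_mono_of_nonneg (Filter.Eventually.of_forall fun x => abs_nonneg _)
            (hi.add ki) (Filter.Eventually.of_forall fun x => ?_)
          refine le_trans (le_of_eq ?_) (abs_add_le _ _)
          change |f x + g x - (h (F.restrict x) + k (G.restrict x))| = _
          congr 1
          ring
      _ ≤ ε := by
          rw [integral_add hi ki]
          linarith

theorem const_mul [Preorder X] {μ : Measure (α → X)} (hf : FinDimApprox μ f) {c : ℝ}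
    (hc : 0 < c) : FinDimApprox μ fun x => c * f x := by
  intro ε hε
  obtain ⟨F, h, hm, hmono, ⟨C, hC⟩, hle⟩ := hf (ε / c) (div_pos hε hc)
  refine ⟨F, fun x => c * h x, hm.const_mul c, fun x y hxy =>
    mul_le_mul_of_nonneg_left (hmono hxy) hc.le, ⟨c * C, fun x => ?_⟩, ?_⟩
  · rw [abs_mul, abs_of_pos hc]
    exact mul_le_mul_of_nonneg_left (hC x) hc.le
  · simp_rw [← mul_sub, abs_mul, abs_of_pos hc]
    rw [integral_const_mul]
    rwa [le_div_iff₀' hc] at hle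

theorem of_forall_abs_sub_le [Preorder X] {μ : Measure (α → X)} [IsProbabilityMeasure μ]
    (hf : ∀ ε > 0, ∃ g : (α → X) → ℝ, Measurable g ∧ (∃ C, ∀ x, |g x| ≤ C) ∧
      FinDimApprox μ g ∧ ∀ x, |f x - g x| ≤ ε) : FinDimApprox μ f := by
  intro ε hε
  obtain ⟨g, hgm, hgb, hg, hfg⟩ := hf (ε / 2) (half_pos hε)
  obtain ⟨F, h, hm, hmono, ⟨C, hC⟩, hle⟩ := hg (ε / 2) (half_pos hε)
  refine ⟨F, h, hm, hmono, ⟨C, hC⟩, ?_⟩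
  have hi : Integrable (fun x => |g x - h (F.restrict x)|) μ :=
    ((integrable_of_abs_le hgm hgb).sub (integrable_of_abs_le
      (hm.comp (measurable_finset_restrict F)) ⟨C, fun x => hC _⟩)).abs
  calc _ ≤ ∫ x, (ε / 2 + |g x - h (F.restrict x)|) ∂μ := by
        refine integral_mono_of_nonneg (Filter.Eventually.of_forall fun x => abs_nonneg _)
          ((integrable_const _).add hi) (Filter.Eventually.of_forall fun x => ?_)
        exact (abs_sub_le _ (g x) _).trans (add_le_add (hfg x) le_rfl)
    _ ≤ ε := by
        rw [integral_add (integrable_const _) hi]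
        simp
        linarith

/-- Indicators of measurable upper sets are approximable: approximate the set from inside by a
compact set `K`, then the upper closure of `K` from outside by finite-dimensional upper sets. -/
theorem indicator [Countable α] [TopologicalSpace X] [PolishSpace X] [BorelSpace X]
    [PartialOrder X] [OrderClosedTopology X] (μ : Measure (α → X)) [IsProbabilityMeasure μ]
    {A : Set (α → X)} (hA : MeasurableSet A) (hup : IsUpperSet A) :
    FinDimApprox μ (A.indicator 1) := by
  intro ε hε
  obtain ⟨K, hKA, hK, hlt⟩ := hA.exists_isCompact_lt_add (measure_ne_top μ A)
    (ε := ENNReal.ofReal (ε / 2)) (by simpa using hε)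
  set U : Finset α → Set (α → X) := fun F =>
    F.restrict ⁻¹' (upperClosure (F.restrict '' K) : Set (F → X)) with hU
  have hclosed (F : Finset α) : IsClosed (upperClosure (F.restrict '' K) : Set (F → X)) :=
    (hK.image (Pi.continuous_domRestrict _)).isClosed_upperClosure
  have hUm (F : Finset α) : MeasurableSet (U F) :=
    measurable_finset_restrict F (hclosed F).measurableSet
  have hanti : Antitone U := by
    intro F G hFG x hx
    obtain ⟨_, ⟨y, hy, rfl⟩, hle⟩ := mem_upperClosure.mp hx
    exact mem_upperClosure.mpr ⟨_, ⟨y, hy, rfl⟩, fun i => hle ⟨i.1, hFG i.2⟩⟩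
  set V : Set (α → X) := ⋂ F, U F with hV
  have hVm : MeasurableSet V := MeasurableSet.iInter hUm
  have hKV : K ⊆ V := fun x hx =>
    Set.mem_iInter.mpr fun F => subset_upperClosure ⟨x, hx, rfl⟩
  have hVA : V ⊆ A := fun x hx => by
    obtain ⟨y, hy, hle⟩ := mem_upperClosure.mp
      (mem_upperClosure_of_forall_restrict hK fun F => Set.mem_iInter.mp hx F)
    exact hup hle (hKA hy)
  have htend : Filter.Tendsto (fun F => μ.real (U F)) Filter.atTop (nhds (μ.real V)) :=
    (ENNReal.tendsto_toReal (measure_ne_top μ V)).comp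
      (tendsto_measure_iInter_atTop (fun F => (hUm F).nullMeasurableSet) hanti
        ⟨∅, measure_ne_top μ _⟩)
  obtain ⟨F, hF⟩ := (htend.eventually_lt_const
    (show μ.real V < μ.real V + ε / 2 by linarith)).exists
  have hVU : V ⊆ U F := Set.iInter_subset _ F
  have hAV : μ.real A ≤ μ.real V + ε / 2 := by
    have h1 : μ A ≤ μ V + ENNReal.ofReal (ε / 2) :=
      hlt.le.trans (add_le_add (measure_mono hKV) le_rfl)
    have h2 := ENNReal.toReal_mono (by finiteness) h1
    rwa [ENNReal.toReal_add (by finiteness) (by finiteness),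
      ENNReal.toReal_ofReal (by positivity)] at h2
  refine ⟨F, Set.indicator (upperClosure (F.restrict '' K) : Set (F → X)) 1,
    measurable_one.indicator (hclosed F).measurableSet,
    (upperClosure (F.restrict '' K)).upper.monotone_indicator_one,
    ⟨1, abs_indicator_one_le _⟩, ?_⟩
  have hint {s : Set (α → X)} (hs : MeasurableSet s) :
      Integrable (s.indicator (1 : (α → X) → ℝ)) μ :=
    integrable_of_abs_le (measurable_one.indicator hs) ⟨1, abs_indicator_one_le _⟩
  have hsub {s : Set (α → X)} (hs : MeasurableSet s) :
      Integrable (fun x => s.indicator (1 : (α → X) → ℝ) x - V.indicator 1 x) μ :=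
    (hint hs).sub (hint hVm)
  have hle {s t : Set (α → X)} (hst : s ⊆ t) (x : α → X) :
      s.indicator (1 : (α → X) → ℝ) x ≤ t.indicator 1 x :=
    Set.indicator_le_indicator_of_subset hst (fun _ => zero_le_one) x
  calc _ ≤ ∫ x, ((A.indicator 1 x - V.indicator 1 x) +
          ((U F).indicator 1 x - V.indicator 1 x)) ∂μ := by
        refine integral_mono_of_nonneg (Filter.Eventually.of_forall fun x => abs_nonneg _)
          ((hsub hA).add (hsub (hUm F)))
          (Filter.Eventually.of_forall fun x => ?_)
        change |A.indicator (1 : (α → X) → ℝ) x - (U F).indicator 1 x| ≤ _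
        have h1 := hle hVA x
        have h2 := hle hVU x
        rw [abs_le]
        constructor <;> linarith
    _ ≤ ε := by
        rw [integral_add (hsub hA) (hsub (hUm F)),
          integral_sub (hint hA) (hint hVm), integral_sub (hint (hUm F)) (hint hVm),
          integral_indicator_one hA, integral_indicator_one hVm, integral_indicator_one (hUm F)]
        linarith

end FinDimApprox

/-- Approximation of `y ∈ [0, N ε]` by a staircase with steps of height `ε`. -/
theorem staircase_approx {ε y : ℝ} (hε : 0 < ε) (hy : 0 ≤ y) (N : ℕ) :
    (N * ε ≤ y → ∑ k ∈ Finset.range N, ε * (if (k + 1) * ε ≤ y then 1 else 0 : ℝ) = N * ε) ∧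
    (y ≤ N * ε →
      |y - ∑ k ∈ Finset.range N, ε * (if (k + 1) * ε ≤ y then 1 else 0 : ℝ)| ≤ ε) := by
  induction N with
  | zero =>
    refine ⟨by simp, fun h => ?_⟩
    have : y = 0 := le_antisymm (by simpa using h) hy
    simp [this, hε.le]
  | succ N ih =>
    rw [Finset.sum_range_succ]
    push_cast
    by_cases h : (N + 1) * ε ≤ y
    · have h1 := ih.1 (by linarith)
      simp only [h, h1, if_true]
      refine ⟨fun _ => by ring, fun h2 => ?_⟩
      rw [abs_le]
      constructor <;> linarith
    · simp only [h, if_false, mul_zero, add_zero]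
      refine ⟨fun h2 => h2.elim, fun _ => ?_⟩
      rcases le_total y (N * ε) with h2 | h2
      · exact ih.2 h2
      · rw [ih.1 h2, abs_le]
        constructor <;> linarith

/-- Bounded measurable nondecreasing functions of countably many coordinates are approximable by
functions of finitely many coordinates. -/
theorem finDimApprox_of_monotone {α X : Type*} [Countable α] [MeasurableSpace X]
    [TopologicalSpace X] [PolishSpace X] [BorelSpace X]
    [PartialOrder X] [OrderClosedTopology X] (μ : Measure (α → X)) [IsProbabilityMeasure μ]
    {f : (α → X) → ℝ} (hf : Measurable f) (hmono : Monotone f) (hb : ∃ C, ∀ x, |f x| ≤ C) :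
    FinDimApprox μ f := by
  obtain ⟨C, hC⟩ := hb
  refine FinDimApprox.of_forall_abs_sub_le fun ε hε => ?_
  obtain ⟨N, hN⟩ := exists_nat_ge (2 * C / ε)
  rw [div_le_iff₀ hε] at hN
  set A : ℕ → Set (α → X) := fun k => {x | (k + 1) * ε ≤ f x + C} with hA
  have hAm (k : ℕ) : MeasurableSet (A k) := measurableSet_le measurable_const (hf.add_const C)
  have hAup (k : ℕ) : IsUpperSet (A k) := fun x y hxy hx =>
    le_trans (show (k + 1) * ε ≤ f x + C from hx) (add_le_add (hmono hxy) le_rfl)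
  have key (n : ℕ) : Measurable (fun x => -C + ∑ k ∈ Finset.range n, ε * (A k).indicator 1 x) ∧
      (∃ D, ∀ x, |-C + ∑ k ∈ Finset.range n, ε * (A k).indicator 1 x| ≤ D) ∧
      FinDimApprox μ (fun x => -C + ∑ k ∈ Finset.range n, ε * (A k).indicator 1 x) := by
    induction n with
    | zero => simpa using ⟨⟨|C|, fun _ => le_rfl⟩, FinDimApprox.const μ (-C)⟩
    | succ n ih =>
      obtain ⟨hm, ⟨D, hD⟩, happ⟩ := ih
      have hm' : Measurable fun x => ε * (A n).indicator 1 x :=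
        (measurable_one.indicator (hAm n)).const_mul ε
      have hb' (x : α → X) : |ε * (A n).indicator 1 x| ≤ ε := by
        rw [abs_mul, abs_of_pos hε]
        exact mul_le_of_le_one_right hε.le (abs_indicator_one_le _ x)
      simp only [Finset.sum_range_succ, ← add_assoc]
      exact ⟨hm.add hm', ⟨D + ε, fun x => (abs_add_le _ _).trans (add_le_add (hD x) (hb' x))⟩,
        happ.add ((FinDimApprox.indicator μ (hAm n) (hAup n)).const_mul hε) hm ⟨D, hD⟩ hm'
          ⟨ε, hb'⟩⟩
  refine ⟨_, (key N).1, (key N).2.1, (key N).2.2, fun x => ?_⟩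
  have hx := abs_le.mp (hC x)
  have h := (staircase_approx hε (show 0 ≤ f x + C by linarith) N).2 (by linarith)
  convert h using 2
  simp only [hA, Set.indicator_apply, Set.mem_ofPred_eq, Pi.one_apply]
  ring

/-- Nonpositivity of the covariance with a bounded function passes to `L¹` limits. -/
theorem integral_mul_le_of_approx {Ω : Type*} [MeasurableSpace Ω] {P : Measure Ω}
    [IsProbabilityMeasure P] {f g : Ω → ℝ} (hf : Measurable f) (hfb : ∃ C, ∀ x, |f x| ≤ C)
    (hg : Measurable g) (hgb : ∃ C, ∀ x, |g x| ≤ C)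
    (happ : ∀ ε > 0, ∃ h : Ω → ℝ, Measurable h ∧ (∃ C, ∀ x, |h x| ≤ C) ∧
      ∫ ω, |f ω - h ω| ∂P ≤ ε ∧ ∫ ω, h ω * g ω ∂P ≤ (∫ ω, h ω ∂P) * ∫ ω, g ω ∂P) :
    ∫ ω, f ω * g ω ∂P ≤ (∫ ω, f ω ∂P) * ∫ ω, g ω ∂P := by
  obtain ⟨D, hD⟩ := hgb
  have hfi := integrable_of_abs_le (μ := P) hf hfb
  have hgi := integrable_of_abs_le (μ := P) hg ⟨D, hD⟩
  have hD' : ∀ᵐ ω ∂P, ‖g ω‖ ≤ D := Filter.Eventually.of_forall hD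
  obtain ⟨ω₀⟩ : Nonempty Ω := P.nonempty_of_neZero
  have hD0 : 0 ≤ D := (abs_nonneg _).trans (hD ω₀)
  refine le_of_forall_pos_le_add fun η hη => ?_
  obtain ⟨h, hm, hb, hle, hcov⟩ := happ (η / (2 * (D + 1))) (by positivity)
  have hhi := integrable_of_abs_le (μ := P) hm hb
  have hbm {u : Ω → ℝ} (hu : Integrable u P) : Integrable (fun ω => u ω * g ω) P :=
    hu.mul_bdd (c := D) hg.aestronglyMeasurable hD'
  have hdi : Integrable (fun ω => |f ω - h ω|) P := (hfi.sub hhi).abs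
  have hsmall : (∫ ω, |f ω - h ω| ∂P) * D ≤ η / 2 := by
    calc _ ≤ η / (2 * (D + 1)) * (D + 1) :=
          mul_le_mul hle (by linarith) hD0 (by positivity)
      _ = η / 2 := by field_simp
  have h1 : ∫ ω, f ω * g ω ∂P - ∫ ω, h ω * g ω ∂P ≤ η / 2 := by
    rw [← integral_sub (hbm hfi) (hbm hhi)]
    refine le_trans ?_ hsmall
    rw [← integral_mul_const]
    refine integral_mono ((hbm hfi).sub (hbm hhi)) (hdi.mul_const D) fun ω => ?_
    change f ω * g ω - h ω * g ω ≤ |f ω - h ω| * D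
    rw [← sub_mul]
    refine (le_abs_self _).trans ?_
    rw [abs_mul]
    exact mul_le_mul_of_nonneg_left (hD ω) (abs_nonneg _)
  have h2 : (∫ ω, h ω ∂P) * ∫ ω, g ω ∂P - (∫ ω, f ω ∂P) * ∫ ω, g ω ∂P ≤ η / 2 := by
    have hgD : |∫ ω, g ω ∂P| ≤ D := by
      simpa using norm_integral_le_of_norm_le_const hD'
    have hfh : |∫ ω, h ω ∂P - ∫ ω, f ω ∂P| ≤ ∫ ω, |f ω - h ω| ∂P := by
      rw [abs_sub_comm, ← integral_sub hfi hhi]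
      exact abs_integral_le_integral_abs
    rw [← sub_mul]
    refine (le_abs_self _).trans (le_trans ?_ hsmall)
    rw [abs_mul]
    exact mul_le_mul hfh hgD (abs_nonneg _) (integral_nonneg fun _ => abs_nonneg _)
  linarith

/-- The negative association inequality for functions of finitely many coordinates. -/
theorem integral_mul_le_of_finite_negAssoc {Ω ι X : Type*} [MeasurableSpace Ω]
    [MeasurableSpace X] [Preorder X] {P : Measure Ω} {Xs : ι → Ω → X}
    (hfin : ∀ F : Finset ι, NegAssoc P (fun (i : F) ω => Xs i.1 ω)) {J : Set ι}
    (F : Finset J) {h : (F → X) → ℝ} (hm : Measurable h) (hmono : Monotone h)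
    (hb : ∃ C, ∀ x, |h x| ≤ C)
    (G : Finset (Jᶜ : Set ι)) {k : (G → X) → ℝ} (km : Measurable k) (kmono : Monotone k)
    (kb : ∃ C, ∀ x, |k x| ≤ C) :
    ∫ ω, h (fun j => Xs j.1 ω) * k (fun j => Xs j.1 ω) ∂P ≤
      (∫ ω, h (fun j => Xs j.1 ω) ∂P) * ∫ ω, k (fun j => Xs j.1 ω) ∂P := by
  classical
  set H : Finset ι := F.image Subtype.val ∪ G.image Subtype.val with hH
  have hF (i : F) : i.1.1 ∈ H :=
    Finset.mem_union_left _ (Finset.mem_image_of_mem _ i.2)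
  have hG (i : G) : i.1.1 ∈ H :=
    Finset.mem_union_right _ (Finset.mem_image_of_mem _ i.2)
  set J' : Set H := {i | i.1 ∈ J} with hJ'
  obtain ⟨C, hC⟩ := hb
  obtain ⟨D, hD⟩ := kb
  exact hfin H J' (fun x => h fun i => x ⟨⟨i.1.1, hF i⟩, i.1.2⟩)
    (fun x => k fun i => x ⟨⟨i.1.1, hG i⟩, i.1.2⟩)
    (hm.comp (measurable_pi_lambda _ fun i => measurable_pi_apply _))
    (fun x y hxy => hmono fun i => hxy _) ⟨C, fun x => hC _⟩
    (km.comp (measurable_pi_lambda _ fun i => measurable_pi_apply _))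
    (fun x y hxy => kmono fun i => hxy _) ⟨D, fun x => hD _⟩

/-- Transfer of the finite-dimensional approximation from the law of a random vector to the
underlying probability space. -/
theorem exists_finDim_approx {Ω α X : Type*} [Countable α] [MeasurableSpace Ω]
    [TopologicalSpace X] [PolishSpace X] [MeasurableSpace X] [BorelSpace X]
    [PartialOrder X] [OrderClosedTopology X]
    (P : Measure Ω) [IsProbabilityMeasure P] {Y : α → Ω → X} (hY : ∀ i, Measurable (Y i))
    {f : (α → X) → ℝ} (hf : Measurable f) (hmono : Monotone f) (hb : ∃ C, ∀ x, |f x| ≤ C)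
    {ε : ℝ} (hε : 0 < ε) :
    ∃ (F : Finset α) (h : (F → X) → ℝ), Measurable h ∧ Monotone h ∧ (∃ C, ∀ x, |h x| ≤ C) ∧
      ∫ ω, |f (fun j => Y j ω) - h (fun j => Y j.1 ω)| ∂P ≤ ε := by
  have hYm : Measurable fun ω j => Y j ω := measurable_pi_lambda _ hY
  have := Measure.isProbabilityMeasure_map (μ := P) hYm.aemeasurable
  obtain ⟨F, h, hm, hmono', hb', hle⟩ :=
    finDimApprox_of_monotone (P.map fun ω j => Y j ω) hf hmono hb ε hε
  refine ⟨F, h, hm, hmono', hb', ?_⟩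
  have hmeas : Measurable fun x => |f x - h (F.restrict x)| :=
    (hf.sub (hm.comp (measurable_finset_restrict F))).norm
  rwa [integral_map hYm.aemeasurable hmeas.aestronglyMeasurable] at hle

/-- If every finite subfamily of a countable family of random elements of a partially
ordered Polish space with closed partial order is negatively associated, then the whole
family is negatively associated. -/
theorem negAssoc_of_finite_negAssoc
    {Ω ι X : Type*} [MeasurableSpace Ω] [Countable ι]
    [TopologicalSpace X] [PolishSpace X] [MeasurableSpace X] [BorelSpace X]
    [PartialOrder X] [OrderClosedTopology X]
    (P : Measure Ω) [IsProbabilityMeasure P]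
    (Xs : ι → Ω → X) (hmeas : ∀ i, Measurable (Xs i))
    (hfin : ∀ F : Finset ι, NegAssoc P (fun (i : F) ω => Xs i.1 ω)) :
    NegAssoc P Xs := by
  intro J f g hf hfmono hfb hg hgmono hgb
  have hsub {K : Set ι} : Measurable fun ω (j : K) => Xs j.1 ω :=
    measurable_pi_lambda _ fun j => hmeas j.1
  have hsub' {K : Set ι} (F : Finset K) : Measurable fun ω (j : F) => Xs j.1.1 ω :=
    measurable_pi_lambda _ fun j => hmeas j.1.1
  obtain ⟨C, hC⟩ := hfb
  obtain ⟨D, hD⟩ := hgb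
  refine integral_mul_le_of_approx (hf.comp hsub) ⟨C, fun _ => hC _⟩ (hg.comp hsub)
    ⟨D, fun _ => hD _⟩ fun ε hε => ?_
  obtain ⟨F, h, hm, hmono, ⟨C', hC'⟩, hle⟩ :=
    exists_finDim_approx P (fun j : J => hmeas j.1) hf hfmono ⟨C, hC⟩ hε
  refine ⟨fun ω => h fun j => Xs j.1.1 ω, hm.comp (hsub' F), ⟨C', fun _ => hC' _⟩, hle, ?_⟩
  simp_rw [mul_comm (h _)]
  rw [mul_comm]
  refine integral_mul_le_of_approx (hg.comp hsub) ⟨D, fun _ => hD _⟩ (hm.comp (hsub' F))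
    ⟨C', fun _ => hC' _⟩ fun δ hδ => ?_
  obtain ⟨G, k, km, kmono, ⟨D', hD'⟩, kle⟩ :=
    exists_finDim_approx P (fun j : (Jᶜ : Set ι) => hmeas j.1) hg hgmono ⟨D, hD⟩ hδ
  refine ⟨fun ω => k fun j => Xs j.1.1 ω, km.comp (hsub' G), ⟨D', fun _ => hD' _⟩, kle, ?_⟩
  have := integral_mul_le_of_finite_negAssoc hfin F hm hmono ⟨C', hC'⟩ G km kmono ⟨D', hD'⟩
  simp_rw [mul_comm (h _)] at this
  rwa [mul_comm (∫ ω, h _ ∂P)] at this
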